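/- Let N ≥ 2, r > 0, δ ∈ πrℤ, and τ ∈ ℂ with Im τ > 0. Then for every x = (x_1,…,x_N) ∈ ℂ^N, with x̄_δ := δ + Σ_{j=1}^N x_j: ϑ1(x̄_δ/(2πr); τ) · ∏_{1≤j<k≤N} ϑ1((x_j − x_k)/(2πr); τ) = C_N^A(τ) · det_{1≤j,k≤N}[ e^{i(k−1)x_j/r} · ϑ1((N−1)/2 + (k−1)τ + (δ + N·x_j)/(2πr); Nτ) ], where C_N^A(τ) = q0(τ)^{(N−1)(N−2)/2} · exp[ (N−1)·((3N−2)τ/8 + δ/(2πr) + (3N−2)/4)·πi ] and q0(τ) = ∏_{n=1}^∞ (1 − e^{2πinτ}). -/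

import Mathlib

/-- The Jacobi theta function
`ϑ1(v;τ) = i ∑_{n ∈ ℤ} (-1)^n e^{iπτ(n-1/2)^2} e^{iπ(2n-1)v}`. -/
noncomputable def theta1 (v τ : ℂ) : ℂ :=
  Complex.I * ∑' n : ℤ, (-1 : ℂ) ^ n *
    Complex.exp (Real.pi * Complex.I * τ * ((n : ℂ) - 1 / 2) ^ 2) *
    Complex.exp (Real.pi * Complex.I * (2 * (n : ℂ) - 1) * v)

/-- `q0(τ) = ∏_{n ≥ 1} (1 - e^{2πinτ})`. -/
noncomputable def q0 (τ : ℂ) : ℂ :=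
  ∏' n : ℕ, (1 - Complex.exp (2 * Real.pi * Complex.I * ((n : ℂ) + 1) * τ))

/-- The infinite q-Pochhammer symbol. -/
noncomputable def PP (Q x : ℂ) : ℂ := ∏' n : ℕ, (1 - Q ^ n * x)

lemma PP_summable {Q : ℂ} (hQ : ‖Q‖ < 1) (x : ℂ) : Summable fun n : ℕ => ‖-(Q ^ n * x)‖ := by
  simp only [norm_neg, norm_mul, norm_pow]
  exact (summable_geometric_of_lt_one (norm_nonneg _) hQ).mul_right _

lemma PP_multipliable {Q : ℂ} (hQ : ‖Q‖ < 1) (x : ℂ) : Multipliable fun n : ℕ => (1 - Q ^ n * x) := by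
  simpa [sub_eq_add_neg] using multipliable_one_add_of_summable (PP_summable hQ x)

lemma PP_tendsto {Q : ℂ} (hQ : ‖Q‖ < 1) (x : ℂ) :
    Filter.Tendsto (fun n => ∏ k ∈ Finset.range n, (1 - Q ^ k * x)) Filter.atTop (nhds (PP Q x)) :=
  (PP_multipliable hQ x).hasProd.tendsto_prod_nat

lemma PP_ne_zero {Q : ℂ} (hQ : ‖Q‖ < 1) (x : ℂ) (h : ∀ n : ℕ, Q ^ n * x ≠ 1) : PP Q x ≠ 0 := by
  have := tprod_one_add_ne_zero_of_summable (f := fun n : ℕ => -(Q ^ n * x))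
    (fun n => by rw [← sub_eq_add_neg, sub_ne_zero]; exact (h n).symm) (PP_summable hQ x)
  simpa [PP, sub_eq_add_neg] using this

lemma PP_succ {Q : ℂ} (hQ : ‖Q‖ < 1) (x : ℂ) : PP Q x = (1 - x) * PP Q (Q * x) := by
  refine tendsto_nhds_unique ((Filter.tendsto_add_atTop_iff_nat 1).2 (PP_tendsto hQ x)) ?_
  refine ((PP_tendsto hQ (Q * x)).const_mul (1 - x)).congr fun n => ?_
  rw [Finset.prod_range_succ', mul_comm, pow_zero, one_mul]
  congr 1
  exact Finset.prod_congr rfl fun k _ => by ring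

lemma PP_dissect {Q : ℂ} (hQ : ‖Q‖ < 1) (x : ℂ) (N : ℕ) (hN : N ≠ 0) :
    ∏ k ∈ Finset.range N, PP (Q ^ N) (Q ^ k * x) = PP Q x := by
  have hQN : ‖Q ^ N‖ < 1 := by rw [norm_pow]; exact pow_lt_one₀ (norm_nonneg _) hQ hN
  have h1 := tendsto_finsetProd (Finset.range N) (fun k _ => PP_tendsto hQN (Q ^ k * x))
  have h2 := (PP_tendsto hQ x).comp (Filter.tendsto_id.atTop_mul_const' (r := N) (Nat.pos_of_ne_zero hN))
  refine tendsto_nhds_unique h1 (h2.congr fun M => ?_)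
  simp only [Function.comp, id]
  rw [Finset.prod_comm]
  induction M with
  | zero => simp
  | succ M ih =>
    rw [add_mul, one_mul, Finset.prod_range_add, ih, Finset.prod_range_succ _ M]
    congr 1
    refine Finset.prod_congr rfl fun k _ => ?_
    rw [← pow_mul, ← mul_assoc, ← pow_add, mul_comm N M]

lemma PP_roots {Q : ℂ} (hQ : ‖Q‖ < 1) (x ζ : ℂ) (N : ℕ) (hN : N ≠ 0) (hζ : IsPrimitiveRoot ζ N) :
    ∏ k ∈ Finset.range N, PP Q (ζ ^ k * x) = PP (Q ^ N) (x ^ N) := by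
  have hQN : ‖Q ^ N‖ < 1 := by rw [norm_pow]; exact pow_lt_one₀ (norm_nonneg _) hQ hN
  have h1 := tendsto_finsetProd (Finset.range N) (fun k _ => PP_tendsto hQ (ζ ^ k * x))
  refine tendsto_nhds_unique h1 ((PP_tendsto hQN (x ^ N)).congr fun M => ?_)
  rw [Finset.prod_comm]
  refine Finset.prod_congr rfl fun n _ => ?_
  have := hζ.pow_sub_pow_eq_prod_sub_mul 1 (Q ^ n * x) (Nat.pos_of_ne_zero hN)
  rw [one_pow, mul_pow, ← pow_mul, mul_comm n N, pow_mul] at this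
  rw [this]
  have : NeZero N := ⟨hN⟩
  symm
  refine Finset.prod_bij (fun k _ => ζ ^ k) ?_ ?_ ?_ ?_
  · intro k _
    rw [Polynomial.mem_nthRootsFinset (Nat.pos_of_ne_zero hN), ← pow_mul, mul_comm, pow_mul, hζ.pow_eq_one, one_pow]
  · intro a ha b hb hab
    exact hζ.pow_inj (Finset.mem_range.1 ha) (Finset.mem_range.1 hb) hab
  · intro b hb
    rw [Polynomial.mem_nthRootsFinset (Nat.pos_of_ne_zero hN)] at hb
    obtain ⟨i, hi, h⟩ := hζ.eq_pow_of_pow_eq_one hb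
    exact ⟨i, Finset.mem_range.2 hi, h⟩
  · intro k _
    ring

/-- Gaussian binomials. -/
def GB (Q : ℂ) : ℕ → ℕ → ℂ
  | _, 0 => 1
  | 0, _ + 1 => 0
  | n + 1, j + 1 => Q ^ (j + 1) * GB Q n (j + 1) + GB Q n j

lemma GB_zero_right (Q : ℂ) (n : ℕ) : GB Q n 0 = 1 := by cases n <;> rfl

lemma GB_eq_zero (Q : ℂ) (n j : ℕ) (h : n < j) : GB Q n j = 0 := by
  induction n generalizing j with
  | zero => obtain ⟨j, rfl⟩ : ∃ i, j = i + 1 := ⟨j - 1, by omega⟩; rfl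
  | succ n ih =>
    obtain ⟨j, rfl⟩ : ∃ i, j = i + 1 := ⟨j - 1, by omega⟩
    rw [GB, ih _ (by omega), ih _ (by omega)]; simp

lemma GB_mul (Q : ℂ) (a b : ℕ) :
    GB Q (a + b) a * (∏ k ∈ Finset.range a, (1 - Q ^ k * Q)) * (∏ k ∈ Finset.range b, (1 - Q ^ k * Q)) =
      ∏ k ∈ Finset.range (a + b), (1 - Q ^ k * Q) := by
  induction a generalizing b with
  | zero => simp [GB_zero_right]
  | succ a iha =>
    induction b with
    | zero =>
      have := iha 0
      simp only [add_zero, Finset.range_zero, Finset.prod_empty, mul_one] at this ⊢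
      rw [GB, GB_eq_zero _ _ _ (Nat.lt_succ_self a), Finset.prod_range_succ]
      linear_combination (1 - Q ^ a * Q) * this
    | succ b ihb =>
      have h1 := iha (b + 1)
      have e : a + 1 + (b + 1) = (a + (b + 1)) + 1 := by ring
      have e2 : a + 1 + b = a + (b + 1) := by ring
      rw [e2] at ihb
      rw [e, GB]
      rw [Finset.prod_range_succ _ a, Finset.prod_range_succ _ b] at *
      rw [Finset.prod_range_succ _ (a + (b + 1))]
      have e3 : Q ^ (a + (b + 1)) * Q = Q ^ (a + 1) * (Q ^ b * Q) := by ring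
      rw [e3]
      linear_combination Q ^ (a + 1) * (1 - Q ^ b * Q) * ihb + (1 - Q ^ a * Q) * h1

lemma qbinom (Q x : ℂ) (n : ℕ) : ∏ k ∈ Finset.range n, (1 - x * Q ^ k) =
    ∑ j ∈ Finset.range (n + 1), (-1) ^ j * Q ^ (j.choose 2) * GB Q n j * x ^ j := by
  induction n generalizing x with
  | zero => simp [GB]
  | succ n ih =>
    rw [Finset.prod_range_succ']
    have : ∏ k ∈ Finset.range n, (1 - x * Q ^ (k + 1)) = ∏ k ∈ Finset.range n, (1 - (x * Q) * Q ^ k) :=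
      Finset.prod_congr rfl fun k _ => by ring
    rw [this, ih, Finset.sum_range_succ' _ (n + 1)]
    have h2 : ∀ j, (-1 : ℂ) ^ (j + 1) * Q ^ ((j + 1).choose 2) * GB Q (n + 1) (j + 1) * x ^ (j + 1) =
       (-1) ^ (j + 1) * Q ^ ((j + 1).choose 2) * GB Q n (j + 1) * (x * Q) ^ (j + 1)
        - x * ((-1) ^ j * Q ^ (j.choose 2) * GB Q n j * (x * Q) ^ j) := by
      intro j
      rw [GB, Nat.choose_succ_succ' j 1, Nat.choose_one_right]
      ring
    simp only [h2]
    rw [Finset.sum_sub_distrib, ← Finset.mul_sum]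
    have h3 := Finset.sum_range_succ' (fun j => (-1) ^ j * Q ^ (j.choose 2) * GB Q n j * (x * Q) ^ j) (n + 1)
    rw [Finset.sum_range_succ, GB_eq_zero _ _ _ (Nat.lt_succ_self n)] at h3
    simp only [GB_zero_right] at h3 ⊢
    simp only [pow_zero, mul_one, Nat.choose_zero_succ] at h3 ⊢
    linear_combination h3

lemma finite_triple (Q w : ℂ) (hQ0 : Q ≠ 0) (hw : w ≠ 0) (a : ℤ → ℂ) (a0 : a 0 = 1)
    (ha : ∀ m, a (m + 1) = -(Q ^ m * w * a m)) (n : ℕ) :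
    (∏ k ∈ Finset.range n, (1 - Q ^ k * w)) * (∏ k ∈ Finset.range n, (1 - Q ^ k * (Q / w))) =
    ∑ j ∈ Finset.range (n + n + 1), a (j - n) * GB Q (n + n) j := by
  have h := qbinom Q (w * (Q ^ n)⁻¹) (n + n)
  have h1 : ∀ n : ℕ, a (-n) * (∏ k ∈ Finset.range n, (-(w * (Q ^ (k + 1))⁻¹))) = 1 := by
    intro n
    induction n with
    | zero => simp [a0]
    | succ n ih =>
      have := ha (-(n + 1 : ℕ))
      rw [show (-((n + 1 : ℕ) : ℤ) + 1) = -n by push_cast; ring] at this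
      rw [this] at ih
      rw [Finset.prod_range_succ]
      rw [zpow_neg, zpow_natCast] at ih
      linear_combination ih
  have h2 : ∀ j : ℕ, a (j - n) = a (-n) * ((-1) ^ j * Q ^ (j.choose 2) * (w * (Q ^ n)⁻¹) ^ j) := by
    intro j
    induction j with
    | zero => simp
    | succ j ih =>
      have := ha (j - n)
      rw [show ((j : ℤ) - n + 1) = (j + 1 : ℕ) - n by push_cast; ring] at this
      rw [this, ih, Nat.choose_succ_succ' j 1, Nat.choose_one_right, zpow_sub₀ hQ0, zpow_natCast, zpow_natCast]
      rw [div_eq_mul_inv]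
      ring
  have h3 : ∏ k ∈ Finset.range (n + n), (1 - w * (Q ^ n)⁻¹ * Q ^ k) =
     (∏ k ∈ Finset.range n, (-(w * (Q ^ (k + 1))⁻¹))) * ((∏ k ∈ Finset.range n, (1 - Q ^ k * w)) * (∏ k ∈ Finset.range n, (1 - Q ^ k * (Q / w)))) := by
    rw [Finset.prod_range_add]
    have e1 : ∏ k ∈ Finset.range n, (1 - w * (Q ^ n)⁻¹ * Q ^ (n + k)) = ∏ k ∈ Finset.range n, (1 - Q ^ k * w) := by
      refine Finset.prod_congr rfl fun k _ => ?_
      rw [pow_add]; field_simp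
    have e2 : ∏ k ∈ Finset.range n, (1 - w * (Q ^ n)⁻¹ * Q ^ k) =
        ∏ k ∈ Finset.range n, (-(w * (Q ^ (k + 1))⁻¹) * (1 - Q ^ k * (Q / w))) := by
      rw [← Finset.prod_range_reflect]
      refine Finset.prod_congr rfl fun k hk => ?_
      have hk := Finset.mem_range.1 hk
      obtain ⟨m, rfl⟩ : ∃ m, n = m + k + 1 := ⟨n - 1 - k, by omega⟩
      have : m + k + 1 - 1 - k = m := by omega
      rw [this]
      field_simp
      ring
    rw [e1, e2, Finset.prod_mul_distrib]
    ring
  rw [h3] at h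
  have h4 : ∀ j : ℕ, a (j - n) * GB Q (n + n) j = a (-n) * ((-1) ^ j * Q ^ (j.choose 2) * GB Q (n + n) j * (w * (Q ^ n)⁻¹) ^ j) := by
    intro j; rw [h2]; ring
  simp only [h4]
  rw [← Finset.mul_sum, ← h, ← mul_assoc, h1, one_mul]

lemma triple_product {Q : ℂ} (hQ : ‖Q‖ < 1) (w : ℂ) (hQ0 : Q ≠ 0) (hw : w ≠ 0) (a : ℤ → ℂ) (a0 : a 0 = 1)
    (ha : ∀ m, a (m + 1) = -(Q ^ m * w * a m)) (hs : Summable a) :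
    ∑' m, a m = PP Q Q * PP Q w * PP Q (Q / w) := by
  set p : ℕ → ℂ := fun n => ∏ k ∈ Finset.range n, (1 - Q ^ k * Q) with hp
  have hpt : Filter.Tendsto p Filter.atTop (nhds (PP Q Q)) := PP_tendsto hQ Q
  have hne : ∀ n : ℕ, Q ^ n * Q ≠ 1 := fun n h => by
    have h1 : ‖Q ^ n * Q‖ < 1 := by
      rw [← pow_succ, norm_pow]; exact pow_lt_one₀ (norm_nonneg _) hQ (by omega)
    rw [h] at h1; simp at h1
  have hP0 : PP Q Q ≠ 0 := PP_ne_zero hQ Q hne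
  have hp0 : ∀ n, p n ≠ 0 := fun n => Finset.prod_ne_zero_iff.2 fun k _ => by
    rw [sub_ne_zero]; exact (hne k).symm
  obtain ⟨B, hB⟩ := (Metric.isBounded_range_of_tendsto p hpt).exists_norm_le
  obtain ⟨B', hB'⟩ := (Metric.isBounded_range_of_tendsto (fun n => (p n)⁻¹) (hpt.inv₀ hP0)).exists_norm_le
  have hB1 : ∀ n, ‖p n‖ ≤ B := fun n => hB _ ⟨n, rfl⟩
  have hB2 : ∀ n, ‖(p n)⁻¹‖ ≤ B' := fun n => hB' _ ⟨n, rfl⟩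
  have hB0 : 0 ≤ B := (norm_nonneg _).trans (hB1 0)
  have hB0' : 0 ≤ B' := (norm_nonneg _).trans (hB2 0)
  have hG : ∀ x y, GB Q (x + y) x = p (x + y) * (p x)⁻¹ * (p y)⁻¹ := fun x y => by
    have h := GB_mul Q x y
    have h' : GB Q (x + y) x * p x * p y = p (x + y) := h
    have := hp0 x
    have := hp0 y
    rw [← h']
    field_simp
  -- the summand
  let f : ℕ → ℤ → ℂ := fun n m => if -(n : ℤ) ≤ m ∧ m ≤ n then a m * GB Q (n + n) (m + n).toNat else 0
  have hf : ∀ (n : ℕ) (m : ℤ), -(n : ℤ) ≤ m ∧ m ≤ n → f n m = a m * (p (n + n) * (p (m + n).toNat)⁻¹ * (p (n - m).toNat)⁻¹) := by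
    intro n m h
    have e : n + n = (m + n).toNat + (n - m).toNat := by omega
    simp only [f, if_pos h]
    rw [e, hG]
  have hfin : ∀ n, ∑' m, f n m = (∏ k ∈ Finset.range n, (1 - Q ^ k * w)) * (∏ k ∈ Finset.range n, (1 - Q ^ k * (Q / w))) := by
    intro n
    rw [finite_triple Q w hQ0 hw a a0 ha]
    rw [tsum_eq_sum (s := Finset.Icc (-(n : ℤ)) n) (fun m hm => by
      simp only [f]; rw [if_neg]; simpa using hm)]
    symm
    refine Finset.sum_bij (fun j _ => (j : ℤ) - n) ?_ ?_ ?_ ?_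
    · intro j hj; have := Finset.mem_range.1 hj; rw [Finset.mem_Icc]; omega
    · intro i _ j _ h; simpa using h
    · intro m hm; rw [Finset.mem_Icc] at hm
      exact ⟨(m + n).toNat, by rw [Finset.mem_range]; omega, by omega⟩
    · intro j hj; have := Finset.mem_range.1 hj
      simp only [f]; rw [if_pos (by omega)]; simp
  have hlim : Filter.Tendsto (fun n => ∑' m, f n m) Filter.atTop (nhds (∑' m, a m * (PP Q Q)⁻¹)) := by
    refine tendsto_tsum_of_dominated_convergence (bound := fun m => ‖a m‖ * (B * B' * B')) (hs.norm.mul_right _) ?_ ?_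
    · intro m
      have t1 : Filter.Tendsto (fun n : ℕ => n + n) Filter.atTop Filter.atTop :=
        Filter.tendsto_atTop_mono (fun n => by simp) Filter.tendsto_id
      have t2 : Filter.Tendsto (fun n : ℕ => (m + n).toNat) Filter.atTop Filter.atTop := by
        rw [Filter.tendsto_atTop]; intro b
        filter_upwards [Filter.eventually_ge_atTop (b + m.natAbs)] with n hn; omega
      have t3 : Filter.Tendsto (fun n : ℕ => (n - m).toNat) Filter.atTop Filter.atTop := by
        rw [Filter.tendsto_atTop]; intro b
        filter_upwards [Filter.eventually_ge_atTop (b + m.natAbs)] with n hn; omega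
      have := (((hpt.comp t1).mul ((hpt.comp t2).inv₀ hP0)).mul ((hpt.comp t3).inv₀ hP0)).const_mul (a m)
      rw [show PP Q Q * (PP Q Q)⁻¹ * (PP Q Q)⁻¹ = (PP Q Q)⁻¹ by field_simp] at this
      refine this.congr' ?_
      filter_upwards [Filter.eventually_ge_atTop m.natAbs] with n hn
      rw [hf n m (by omega)]; rfl
    · refine Filter.Eventually.of_forall fun n m => ?_
      by_cases h : -(n : ℤ) ≤ m ∧ m ≤ n
      · rw [hf n m h, norm_mul, norm_mul, norm_mul]
        gcongr
        · exact hB1 _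
        · exact hB2 _
        · exact hB2 _
      · simp only [f, if_neg h, norm_zero]; positivity
  simp only [hfin] at hlim
  have := tendsto_nhds_unique hlim ((PP_tendsto hQ w).mul (PP_tendsto hQ (Q / w)))
  rw [tsum_mul_right] at this
  field_simp at this
  rw [this]

section thetasec
open Complex

lemma theta1_eq (v τ : ℂ) : theta1 v τ = I * exp (Real.pi * I * τ / 4) * exp (-(Real.pi * I * v)) *
    jacobiTheta₂ (v - τ / 2 + 1 / 2) τ := by
  rw [theta1, jacobiTheta₂, ← tsum_mul_left, ← tsum_mul_left]
  refine tsum_congr fun n => ?_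
  rw [jacobiTheta₂_term]
  have : (-1 : ℂ) ^ n = exp (Real.pi * I * n) := by
    rw [← exp_pi_mul_I, ← exp_int_mul, mul_comm]
  rw [this, mul_assoc I, mul_assoc I]
  simp only [← exp_add]
  congr 2
  ring

lemma theta1_differentiable {τ : ℂ} (hτ : 0 < τ.im) : Differentiable ℂ fun v => theta1 v τ := by
  simp only [theta1_eq]
  intro v
  have : DifferentiableAt ℂ (fun v => jacobiTheta₂ (v - τ / 2 + 1 / 2) τ) v :=
    (differentiableAt_jacobiTheta₂_fst (v - τ / 2 + 1 / 2) hτ).comp v (f := fun v => v - τ / 2 + 1 / 2) (by fun_prop)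
  fun_prop

lemma theta1_add_one (v τ : ℂ) : theta1 (v + 1) τ = -theta1 v τ := by
  rw [theta1_eq, theta1_eq, show v + 1 - τ / 2 + 1 / 2 = (v - τ / 2 + 1 / 2) + 1 by ring,
    jacobiTheta₂_add_left, mul_add, mul_one, neg_add, exp_add, exp_neg (Real.pi * I), exp_pi_mul_I]
  ring

lemma theta1_add_tau (v τ : ℂ) : theta1 (v + τ) τ = -exp (-(Real.pi * I * τ) - 2 * Real.pi * I * v) * theta1 v τ := by
  rw [theta1_eq, theta1_eq, show v + τ - τ / 2 + 1 / 2 = (v - τ / 2 + 1 / 2) + τ by ring,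
    jacobiTheta₂_add_left']
  have : (-1 : ℂ) = exp (-(Real.pi * I)) := by rw [exp_neg, exp_pi_mul_I]; norm_num
  have h : exp (-(Real.pi * I * (v + τ))) * exp (-Real.pi * I * (τ + 2 * (v - τ / 2 + 1 / 2))) =
     -exp (-(Real.pi * I * τ) - 2 * Real.pi * I * v) * exp (-(Real.pi * I * v)) := by
    rw [neg_eq_neg_one_mul (exp _), this]
    simp only [← exp_add]
    congr 1; ring
  linear_combination (I * exp (Real.pi * I * τ / 4) * jacobiTheta₂ (v - τ / 2 + 1 / 2) τ) * h

lemma theta1_neg (v τ : ℂ) : theta1 (-v) τ = -theta1 v τ := by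
  rw [theta1_eq, theta1_eq, ← jacobiTheta₂_neg_left]
  rw [show -(-v - τ / 2 + 1 / 2) = (v - τ / 2 - 1 / 2) + τ by ring, jacobiTheta₂_add_left']
  rw [show v - τ / 2 + 1 / 2 = (v - τ / 2 - 1 / 2) + 1 by ring, jacobiTheta₂_add_left]
  have : (-1 : ℂ) = exp ((Real.pi * I)) := by rw [exp_pi_mul_I]
  have h : exp (-(Real.pi * I * -v)) * exp (-Real.pi * I * (τ + 2 * (v - τ / 2 - 1 / 2))) = - exp (-(Real.pi * I * v)) := by
    rw [neg_eq_neg_one_mul (exp _), this]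
    simp only [← exp_add]
    congr 1; ring
  linear_combination (I * exp (Real.pi * I * τ / 4) * jacobiTheta₂ (v - τ / 2 - 1 / 2) τ) * h

lemma norm_Q {τ : ℂ} (hτ : 0 < τ.im) : ‖exp (2 * Real.pi * I * τ)‖ < 1 := by
  rw [norm_exp]
  simp
  positivity

lemma q0_eq (τ : ℂ) : q0 τ = PP (exp (2 * Real.pi * I * τ)) (exp (2 * Real.pi * I * τ)) := by
  rw [q0, PP]
  refine tprod_congr fun n => ?_
  rw [← exp_nat_mul, ← exp_add]; ring_nf

lemma theta1_prod (v : ℂ) {τ : ℂ} (hτ : 0 < τ.im) :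
    theta1 v τ = I * exp (Real.pi * I * τ / 4) * exp (-(Real.pi * I * v)) *
      (q0 τ * PP (exp (2 * Real.pi * I * τ)) (exp (2 * Real.pi * I * v)) *
        PP (exp (2 * Real.pi * I * τ)) (exp (2 * Real.pi * I * τ) / exp (2 * Real.pi * I * v))) := by
  rw [theta1_eq, q0_eq, ← triple_product (norm_Q hτ) _ (exp_ne_zero _) (exp_ne_zero _)
    (fun n => jacobiTheta₂_term n (v - τ / 2 + 1 / 2) τ)]
  · rfl
  · simp [jacobiTheta₂_term]
  · intro m
    simp only [jacobiTheta₂_term]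
    have : (-1 : ℂ) = exp ((Real.pi * I)) := by rw [exp_pi_mul_I]
    rw [neg_eq_neg_one_mul, this, ← exp_int_mul]
    simp only [← exp_add]
    congr 1; push_cast; ring
  · exact (summable_jacobiTheta₂_term_iff _ _).2 hτ

end thetasec

open Complex in
lemma shift_integral (g : ℂ → ℂ) (hd : Differentiable ℂ g) (hp : ∀ u, g (u + 1) = g u) (a : ℂ) :
    ∫ t in (0:ℝ)..1, g (t + a) = ∫ t in (0:ℝ)..1, g t := by
  have h1 := Complex.integral_boundary_rect_eq_zero_of_differentiableOn g (a.re : ℂ)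
    ((a.re + 1 : ℝ) + a.im * I) hd.differentiableOn
  simp at h1
  have h2 : ∀ y : ℝ, g (a.re + 1 + y * I) = g (a.re + y * I) := fun y => by
    rw [← hp (a.re + y * I)]; ring_nf
  simp only [h2] at h1
  have h3 : ∫ x in a.re..a.re+1, g x = ∫ x in (0:ℝ)..1, g x := by
    have := Function.Periodic.intervalIntegral_add_eq (f := fun x : ℝ => g x) (T := 1)
      (fun x => by simp [hp]) a.re 0
    simpa using this
  have h4 : ∫ t in (0:ℝ)..1, g (t + a) = ∫ x in a.re..a.re+1, g (x + a.im * I) := by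
    have := intervalIntegral.integral_comp_add_right (a := 0) (b := 1) (fun x : ℝ => g (x + a.im * I)) a.re
    rw [zero_add, add_comm 1] at this
    rw [← this]
    refine intervalIntegral.integral_congr fun t _ => ?_
    congr 1
    conv_lhs => rw [← Complex.re_add_im a]
    push_cast; ring
  rw [h4, ← h3]
  linear_combination -h1

open Complex in
lemma fourier_unique (h : ℂ → ℂ) (hd : Differentiable ℂ h) (hp : ∀ u, h (u + 1) = h u)
    (τ A : ℂ) (hA : A ≠ 0) (hq : ∀ u, h (u + τ) = A * exp (-(2 * Real.pi * I * u)) * h u)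
    (h0 : ∫ t in (0:ℝ)..1, h t = 0) (a : ℂ) : h a = 0 := by
  set g : ℤ → ℂ → ℂ := fun n z => h z * exp (-(2 * Real.pi * I * n * z)) with hg
  have gd : ∀ n, Differentiable ℂ (g n) := fun n => by
    apply hd.mul; fun_prop
  have gp : ∀ n u, g n (u + 1) = g n u := fun n u => by
    simp only [hg, hp]
    congr 1
    rw [Complex.exp_eq_exp_iff_exists_int]
    exact ⟨-n, by push_cast; ring⟩
  have key : ∀ n : ℤ, ∫ t in (0:ℝ)..1, g n t = A * exp (-(2 * Real.pi * I * n * τ)) *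
      ∫ t in (0:ℝ)..1, g (n+1) t := fun n => by
    rw [← shift_integral _ (gd n) (gp n) τ, ← intervalIntegral.integral_const_mul]
    refine intervalIntegral.integral_congr fun t _ => ?_
    simp only [hg, hq]
    have : exp (-(2 * Real.pi * I * (n+1:ℤ) * t)) = exp (-(2 * Real.pi * I * t)) * exp (-(2 * Real.pi * I * n * t)) := by
      rw [← exp_add]; push_cast; ring_nf
    have h' : exp (-(2 * Real.pi * I * n * (t + τ))) = exp (-(2 * Real.pi * I * n * τ)) * exp (-(2 * Real.pi * I * n * t)) := by
      rw [← exp_add]; push_cast; ring_nf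
    rw [this, h']; ring
  have c0 : ∀ n : ℤ, ∫ t in (0:ℝ)..1, g n t = 0 := by
    intro n
    induction n using Int.induction_on with
    | zero => simpa [hg] using h0
    | succ n ih =>
      have := key n
      rw [ih] at this
      have h2 := mul_ne_zero hA (exp_ne_zero (-(2 * Real.pi * I * (n:ℤ) * τ)))
      exact (mul_eq_zero.mp this.symm).resolve_left h2
    | pred n ih =>
      rw [key, sub_add_cancel, ih, mul_zero]
  have per : Function.Periodic (fun t : ℝ => h (t + a)) 1 := fun t => by
    simp only; rw [← hp (t + a)]; push_cast; ring_nf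
  have : Fact ((0:ℝ) < 1) := ⟨one_pos⟩
  have hc : Continuous (fun t : ℝ => h (t + a)) := hd.continuous.comp (by fun_prop)
  let f : C(AddCircle (1:ℝ), ℂ) := ⟨per.lift, by
    exact continuous_coinduced_dom.mpr hc⟩
  have fc : ∀ n, fourierCoeff f n = 0 := fun n => by
    rw [fourierCoeff_eq_intervalIntegral _ _ 0]
    have e : ∀ x : ℝ, fourier (T := (1:ℝ)) (-n) x • f x = exp (2 * Real.pi * I * n * a) * g n (x + a) := by
      intro x
      have : f (x : AddCircle (1:ℝ)) = h (x + a) := rfl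
      rw [this, fourier_coe_apply, smul_eq_mul]
      simp only [hg]
      rw [mul_left_comm, ← exp_add, mul_comm]
      congr 2; push_cast; ring
    simp only [e, zero_add]
    rw [intervalIntegral.integral_const_mul, shift_integral _ (gd n) (gp n), c0]; simp
  have := has_pointwise_sum_fourier_series_of_summable (f := f) (by
    rw [show fourierCoeff f = 0 from funext fc]; exact summable_zero) ((0:ℝ) : AddCircle (1:ℝ))
  simp only [fc] at this
  have e : f ((0:ℝ) : AddCircle (1:ℝ)) = h ((0:ℝ) + a) := rfl
  rw [e] at this
  simpa using this.unique (by simp)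

open Complex in
/-- One-dimensionality. -/
lemma one_dim (h φ : ℂ → ℂ) (hd : Differentiable ℂ h) (φd : Differentiable ℂ φ)
    (N : ℂ) (hN : N ≠ 0) (τ μ A : ℂ) (hμ : μ ≠ 0) (hA : A ≠ 0)
    (h1 : ∀ u, h (u + 1 / N) = μ * h u) (φ1 : ∀ u, φ (u + 1 / N) = μ * φ u)
    (h2 : ∀ u, h (u + τ) = A * exp (-(2 * Real.pi * I * N * u)) * h u)
    (φ2 : ∀ u, φ (u + τ) = A * exp (-(2 * Real.pi * I * N * u)) * φ u)
    (s : ℂ) (hs : h s = 0) (φs : φ s ≠ 0) (u : ℂ) : h u = 0 := by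
  set c := log μ with hc
  have hμ' : exp c = μ := exp_log hμ
  have main : ∀ f : ℂ → ℂ, Differentiable ℂ f → (∀ u, f (u + 1 / N) = μ * f u) →
      (∀ u, f (u + τ) = A * exp (-(2 * Real.pi * I * N * u)) * f u) →
      (∫ t in (0:ℝ)..1, f (t / N) * exp (-(c * t)) = 0) → ∀ u, f u = 0 := by
    intro f fd f1 f2 f0 u
    have := fourier_unique (fun z => f (z / N) * exp (-(c * z))) (by
      apply Differentiable.mul
      · exact fd.comp (by fun_prop)
      · fun_prop) (fun u => by
        rw [add_div, f1, mul_add, mul_one, neg_add, exp_add, exp_neg c, hμ']; field_simp) (N * τ)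
      (A * exp (-(c * (N * τ)))) (mul_ne_zero hA (exp_ne_zero _)) (fun u => by
        have : (u + N * τ) / N = u / N + τ := by field_simp
        rw [this, f2, mul_add, neg_add, exp_add]
        have : 2 * Real.pi * I * N * (u / N) = 2 * Real.pi * I * u := by field_simp
        rw [this]; ring) f0 (u * N)
    have h3 : u * N / N = u := by field_simp
    rw [h3] at this
    exact (mul_eq_zero.mp this).resolve_right (exp_ne_zero _)
  set a := ∫ t in (0:ℝ)..1, h (t / N) * exp (-(c * t)) with ha
  set b := ∫ t in (0:ℝ)..1, φ (t / N) * exp (-(c * t)) with hb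
  have hcont : ∀ f : ℂ → ℂ, Differentiable ℂ f → IntervalIntegrable (fun t : ℝ => f (t / N) * exp (-(c * t))) MeasureTheory.volume 0 1 := by
    intro f fd
    apply Continuous.intervalIntegrable
    have := fd.continuous
    fun_prop
  have hb0 : b ≠ 0 := fun hb' => φs (main φ φd φ1 φ2 hb' s)
  have hz : ∀ u, b * h u - a * φ u = 0 := by
    refine main (fun u => b * h u - a * φ u) (by fun_prop) (fun u => ?_) (fun u => ?_) ?_
    · simp only [h1, φ1]; ring
    · simp only [h2, φ2]; ring
    · have : ∀ t : ℝ, (b * h (t / N) - a * φ (t / N)) * exp (-(c * t)) =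
        b * (h (t / N) * exp (-(c * t))) - a * (φ (t / N) * exp (-(c * t))) := fun t => by ring
      simp only [this]
      rw [intervalIntegral.integral_sub ((hcont h hd).const_mul _) ((hcont φ φd).const_mul _),
        intervalIntegral.integral_const_mul, intervalIntegral.integral_const_mul, ← ha, ← hb]
      ring
  have ha0 : a = 0 := by
    have := hz s
    rw [hs] at this
    simpa [φs] using this
  have := hz u
  rw [ha0] at this
  simpa [hb0] using this

section detsec
open Complex

/-- Space of entire functions with the relevant quasi-periodicity. -/
def InV (N : ℕ) (d τ : ℂ) (f : ℂ → ℂ) : Prop :=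
  Differentiable ℂ f ∧ (∀ u, f (u + 1) = (-1) ^ N * f u) ∧
  ∀ u, f (u + τ) = ((-1) ^ N * exp (-(Real.pi * I * N * τ) - 2 * Real.pi * I * d)) *
    exp (-(2 * Real.pi * I * N * u)) * f u

/-- The basis functions. -/
noncomputable def phi (N : ℕ) (d τ : ℂ) (k : ℕ) (u : ℂ) : ℂ :=
  exp (2 * Real.pi * I * k * u) * theta1 (((N : ℂ) - 1) / 2 + k * τ + d + N * u) (N * τ)

lemma theta1_add_nat (v τ : ℂ) (n : ℕ) : theta1 (v + n) τ = (-1) ^ n * theta1 v τ := by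
  induction n with
  | zero => simp
  | succ n ih => push_cast; rw [← add_assoc, theta1_add_one, ih]; ring

lemma exp_pi_nat (n : ℕ) : exp (Real.pi * I * n) = (-1) ^ n := by
  rw [mul_comm, exp_nat_mul, exp_pi_mul_I]

lemma exp_pi_nat_neg (n : ℕ) : exp (-(Real.pi * I * n)) = (-1) ^ n := by
  rw [exp_neg, exp_pi_nat, ← inv_pow]; norm_num

lemma phi_inV (N : ℕ) (hN : N ≠ 0) (d τ : ℂ) (hτ : 0 < τ.im) (k : ℕ) : InV N d τ (phi N d τ k) := by
  have hNτ : 0 < ((N : ℂ) * τ).im := by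
    have : (0:ℝ) < N := by positivity
    simp; positivity
  refine ⟨?_, ?_, ?_⟩
  · have h := (theta1_differentiable hNτ).comp (f := fun u : ℂ => ((N : ℂ) - 1) / 2 + k * τ + d + N * u) (by fun_prop)
    exact Differentiable.mul (by fun_prop) h
  · intro u
    simp only [phi]
    rw [show ((N : ℂ) - 1) / 2 + k * τ + d + N * (u + 1) = (((N : ℂ) - 1) / 2 + k * τ + d + N * u) + N by ring,
      theta1_add_nat, mul_add, exp_add, mul_one, show 2 * Real.pi * I * (k : ℂ) = k * (2 * Real.pi * I) by ring, exp_nat_mul_two_pi_mul_I]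
    ring
  · intro u
    simp only [phi]
    rw [show ((N : ℂ) - 1) / 2 + k * τ + d + N * (u + τ) = (((N : ℂ) - 1) / 2 + k * τ + d + N * u) + N * τ by ring,
      theta1_add_tau]
    have h : exp (2 * Real.pi * I * k * (u + τ)) * -exp (-(Real.pi * I * (N * τ)) - 2 * Real.pi * I * (((N : ℂ) - 1) / 2 + k * τ + d + N * u))
      = (-1) ^ N * exp (-(Real.pi * I * N * τ) - 2 * Real.pi * I * d) * exp (-(2 * Real.pi * I * N * u)) * exp (2 * Real.pi * I * k * u) := by
      have hm : (-1 : ℂ) = exp (-(Real.pi * I)) := by rw [exp_neg, exp_pi_mul_I]; norm_num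
      rw [← exp_pi_nat_neg, neg_eq_neg_one_mul, hm]
      simp only [← exp_add]
      congr 1; ring
    linear_combination theta1 (((N : ℂ) - 1) / 2 + k * τ + d + N * u) (N * τ) * h

lemma phi_add_inv (N : ℕ) (hN : N ≠ 0) (d τ : ℂ) (k : ℕ) (u : ℂ) :
    phi N d τ k (u + 1 / N) = -exp (2 * Real.pi * I / N) ^ k * phi N d τ k u := by
  have hN' : (N : ℂ) ≠ 0 := by exact_mod_cast hN
  simp only [phi]
  rw [show ((N : ℂ) - 1) / 2 + k * τ + d + N * (u + 1 / N) = (((N : ℂ) - 1) / 2 + k * τ + d + N * u) + 1 by field_simp; ring,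
      theta1_add_one, ← exp_nat_mul, mul_add, exp_add]
  ring_nf

lemma inV_zero (N : ℕ) (hN : N ≠ 0) (d τ : ℂ) (hτ : 0 < τ.im) (s : ℂ)
    (hs : ∀ k < N, phi N d τ k s ≠ 0) (f : ℂ → ℂ) (hf : InV N d τ f)
    (hz : ∀ j < N, f (s + j / N) = 0) (u : ℂ) : f u = 0 := by
  have hN' : (N : ℂ) ≠ 0 := by exact_mod_cast hN
  have hζ := Complex.isPrimitiveRoot_exp N hN
  set ζ := exp (2 * Real.pi * I / N) with hζd
  have hζ0 : ζ ≠ 0 := exp_ne_zero _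
  obtain ⟨fd, f1, f2⟩ := hf
  have hh : ∀ k < N, ∑ j ∈ Finset.range N, ((-ζ ^ k)⁻¹) ^ j * f (u + j / N) = 0 := by
    intro k hk
    have hμ : -ζ ^ k ≠ 0 := neg_ne_zero.2 (pow_ne_zero _ hζ0)
    refine one_dim (fun u => ∑ j ∈ Finset.range N, ((-ζ ^ k)⁻¹) ^ j * f (u + j / N)) (phi N d τ k) ?_
      (phi_inV N hN d τ hτ k).1 N hN' τ (-ζ ^ k) ((-1) ^ N * exp (-(Real.pi * I * N * τ) - 2 * Real.pi * I * d))
      hμ (mul_ne_zero (by simp) (exp_ne_zero _)) ?_ (phi_add_inv N hN d τ k) ?_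
      (phi_inV N hN d τ hτ k).2.2 s ?_ (hs k hk) u
    · refine Differentiable.fun_sum fun j _ => ?_
      exact (fd.comp (f := fun u : ℂ => u + j / N) (by fun_prop)).const_mul _
    · intro u
      have h1 := Finset.sum_range_succ (fun j : ℕ => ((-ζ ^ k)⁻¹) ^ j * f (u + j / N)) N
      rw [Finset.sum_range_succ'] at h1
      have e1 : f (u + (N : ℕ) / N) = (-1) ^ N * f u := by rw [div_self hN', f1]
      have e2 : ((-ζ ^ k)⁻¹) ^ N * (-1) ^ N = 1 := by
        rw [← mul_pow, inv_neg, neg_mul_neg, mul_one, inv_pow, ← pow_mul, mul_comm, pow_mul, hζ.pow_eq_one]; simp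
      rw [e1, ← mul_assoc, e2] at h1
      simp only [pow_zero, Nat.cast_zero, zero_div, add_zero, add_left_inj, one_mul] at h1
      rw [← h1, Finset.mul_sum]
      refine Finset.sum_congr rfl fun j _ => ?_
      rw [show u + 1 / N + j / (N : ℂ) = u + (j + 1 : ℕ) / N by push_cast; ring, pow_succ]
      field_simp
    · intro u
      rw [Finset.mul_sum]
      refine Finset.sum_congr rfl fun j _ => ?_
      rw [show u + τ + j / (N : ℂ) = u + j / N + τ by ring, f2]
      have : exp (-(2 * Real.pi * I * N * (u + j / N))) = exp (-(2 * Real.pi * I * N * u)) := by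
        rw [exp_eq_exp_iff_exists_int]
        exact ⟨-j, by push_cast; field_simp; ring⟩
      rw [this]; ring
    · exact Finset.sum_eq_zero fun j hj => by rw [hz j (Finset.mem_range.1 hj), mul_zero]
  have hsum : ∑ k ∈ Finset.range N, ∑ j ∈ Finset.range N, ((-ζ ^ k)⁻¹) ^ j * f (u + j / N) = 0 :=
    Finset.sum_eq_zero fun k hk => hh k (Finset.mem_range.1 hk)
  rw [Finset.sum_comm, Finset.sum_eq_single 0] at hsum
  · simpa [hN] using hsum
  · intro j hj hj0
    have hx : ζ⁻¹ ^ j ≠ 1 := by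
      rw [inv_pow, ne_eq, inv_eq_one]
      exact hζ.pow_ne_one_of_pos_of_lt hj0 (Finset.mem_range.1 hj)
    have hx2 : (ζ⁻¹ ^ j) ^ N = 1 := by
      rw [← pow_mul, mul_comm, pow_mul, inv_pow, hζ.pow_eq_one]; simp
    have hg := geom_sum_eq hx N
    rw [hx2, sub_self, zero_div] at hg
    have : ∀ k ∈ Finset.range N, ((-ζ ^ k)⁻¹) ^ j * f (u + j / N) = (ζ⁻¹ ^ j) ^ k * ((-1) ^ j * f (u + j / N)) := by
      intro k _
      have : (-ζ ^ k)⁻¹ = -1 * ζ⁻¹ ^ k := by rw [inv_neg, inv_pow]; ring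
      rw [this, mul_pow, ← pow_mul, ← pow_mul, mul_comm k j]; ring
    rw [Finset.sum_congr rfl this, ← Finset.sum_mul, hg, zero_mul]
  · intro h; exact absurd (Finset.mem_range.2 (Nat.pos_of_ne_zero hN)) h

lemma alt_zero {n : ℕ} (H : (Fin (n + 1) → ℂ) → ℂ) (w : Fin (n + 1) → ℂ)
    (hperm : ∀ x (σ : Equiv.Perm (Fin (n + 1))), H (x ∘ σ) = (Equiv.Perm.sign σ : ℤ) * H x)
    (hw : H w = 0)
    (hz : ∀ y : Fin n → ℂ, (∀ j, H (Fin.cons (w j) y) = 0) → ∀ u, H (Fin.cons u y) = 0)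
    (x : Fin (n + 1) → ℂ) : H x = 0 := by
  have main : ∀ s : Finset (Fin (n + 1)), ∀ x : Fin (n + 1) → ℂ, (∀ i, i ∉ s → ∃ j, x i = w j) → H x = 0 := by
    intro s
    induction s using Finset.induction_on with
    | empty =>
      intro x hx
      choose σ hσ using fun i => hx i (Finset.notMem_empty i)
      by_cases hinj : Function.Injective σ
      · have hb : Function.Bijective σ := Finite.injective_iff_bijective.1 hinj
        have : x = w ∘ (Equiv.ofBijective σ hb) := funext hσ
        rw [this, hperm, hw, mul_zero]
      · simp only [Function.Injective, not_forall] at hinj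
        obtain ⟨i, j, hij, hne⟩ := hinj
        have h := hperm x (Equiv.swap i j)
        have e : x ∘ (Equiv.swap i j) = x := by
          funext k
          simp only [Function.comp]
          by_cases h1 : k = i
          · subst h1; rw [Equiv.swap_apply_left, hσ, hσ, hij]
          · by_cases h2 : k = j
            · subst h2; rw [Equiv.swap_apply_right, hσ, hσ, hij]
            · rw [Equiv.swap_apply_of_ne_of_ne h1 h2]
        rw [e, Equiv.Perm.sign_swap hne] at h
        push_cast at h
        linear_combination h / 2
    | insert i s _ ih =>
      intro x hx
      set x' := x ∘ (Equiv.swap 0 i) with hx'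
      have h0 : H x' = 0 := by
        have e : x' = Fin.cons (x' 0) (Fin.tail x') := (Fin.cons_self_tail x').symm
        rw [e]
        refine hz _ (fun j => ?_) _
        have h2 : H ((Fin.cons (w j) (Fin.tail x') : Fin (n + 1) → ℂ) ∘ (Equiv.swap 0 i)) = 0 := by
          refine ih _ fun l hl => ?_
          by_cases hli : l = i
          · subst hli; exact ⟨j, by simp⟩
          · have hne : Equiv.swap 0 i l ≠ 0 := by
              intro h
              apply hli
              have := congrArg (Equiv.swap 0 i) h
              simpa using this
            obtain ⟨m, hm⟩ := Fin.exists_succ_eq.2 hne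
            have : (Fin.cons (w j) (Fin.tail x') : Fin (n + 1) → ℂ) (Equiv.swap 0 i l) = x l := by
              rw [← hm, Fin.cons_succ, Fin.tail, hx', hm]; simp
            simp only [Function.comp, this]
            exact hx l (by simp [hli, hl])
        rw [hperm] at h2
        exact (mul_eq_zero.1 h2).resolve_left (by
          rcases Int.units_eq_one_or (Equiv.Perm.sign (Equiv.swap 0 i)) with h | h <;> simp [h])
      rw [hx', hperm] at h0
      exact (mul_eq_zero.1 h0).resolve_left (by
          rcases Int.units_eq_one_or (Equiv.Perm.sign (Equiv.swap 0 i)) with h | h <;> simp [h])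
  exact main Finset.univ x (by simp)

/-- Left-hand side -/
noncomputable def FF (N : ℕ) (d τ : ℂ) (x : Fin N → ℂ) : ℂ :=
  theta1 (d + ∑ i, x i) τ * ∏ j, ∏ k ∈ Finset.Ioi j, theta1 (x j - x k) τ

/-- Determinant -/
noncomputable def DD (N : ℕ) (d τ : ℂ) (x : Fin N → ℂ) : ℂ :=
  Matrix.det (Matrix.of fun j k : Fin N => phi N d τ k (x j))

lemma FF_perm (N : ℕ) (d τ : ℂ) (x : Fin N → ℂ) (σ : Equiv.Perm (Fin N)) :
    FF N d τ (x ∘ σ) = (Equiv.Perm.sign σ : ℤ) * FF N d τ x := by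
  have h := Equiv.Perm.prod_Ioi_comp_eq_sign_mul_prod σ (f := fun j k => theta1 (x j - x k) τ)
    (fun i j => by rw [← theta1_neg, neg_sub])
  simp only [FF, Function.comp]
  rw [h, Equiv.sum_comp σ x]
  ring

lemma DD_perm (N : ℕ) (d τ : ℂ) (x : Fin N → ℂ) (σ : Equiv.Perm (Fin N)) :
    DD N d τ (x ∘ σ) = (Equiv.Perm.sign σ : ℤ) * DD N d τ x := by
  exact Matrix.det_permute σ (Matrix.of fun j k : Fin N => phi N d τ k (x j))

lemma FF_inV (n : ℕ) (d τ : ℂ) (hτ : 0 < τ.im) (y : Fin n → ℂ) :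
    InV (n + 1) d τ (fun u => FF (n + 1) d τ (Fin.cons u y)) := by
  have hF : ∀ u, FF (n + 1) d τ (Fin.cons u y) = theta1 (d + ∑ i, y i + u) τ * (∏ k, theta1 (u - y k) τ) *
      (∏ j, ∏ k ∈ Finset.Ioi j, theta1 (y j - y k) τ) := by
    intro u
    have : d + (u + ∑ i, y i) = d + ∑ i, y i + u := by ring
    simp only [FF, Fin.sum_univ_succ, Fin.prod_univ_succ, Fin.cons_zero, Fin.cons_succ, Fin.prod_Ioi_zero, Fin.prod_Ioi_succ, this]
    ring
  simp only [hF]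
  have hd := theta1_differentiable hτ
  refine ⟨?_, ?_, ?_⟩
  · refine Differentiable.mul_const (Differentiable.mul ?_ ?_) _
    · exact hd.comp (f := fun u : ℂ => d + ∑ i, y i + u) (by fun_prop)
    · refine Differentiable.fun_finsetProd fun k _ => ?_
      exact hd.comp (f := fun u : ℂ => u - y k) (by fun_prop)
  · intro u
    have : ∀ k, theta1 (u + 1 - y k) τ = -1 * theta1 (u - y k) τ := fun k => by
      rw [show u + 1 - y k = u - y k + 1 by ring, theta1_add_one]; ring
    simp only [this, Finset.prod_mul_distrib, Finset.prod_const, Finset.card_univ, Fintype.card_fin]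
    rw [← add_assoc, theta1_add_one]
    ring
  · intro u
    have : ∀ k, theta1 (u + τ - y k) τ = -1 * exp (-(Real.pi * I * τ) - 2 * Real.pi * I * (u - y k)) * theta1 (u - y k) τ := fun k => by
      rw [show u + τ - y k = u - y k + τ by ring, theta1_add_tau]; ring
    simp only [this, Finset.prod_mul_distrib, Finset.prod_const, Finset.card_univ, Fintype.card_fin]
    rw [← add_assoc, theta1_add_tau, ← exp_sum, Finset.sum_sub_distrib, ← Finset.mul_sum, Finset.sum_sub_distrib]
    simp only [Finset.sum_const, Finset.card_univ, Fintype.card_fin, nsmul_eq_mul]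
    have h : exp (-(Real.pi * I * τ) - 2 * Real.pi * I * (d + ∑ i, y i + u)) * exp (n * (-(Real.pi * I * τ)) - 2 * Real.pi * I * (n * u - ∑ i, y i))
      = exp (-(Real.pi * I * (n + 1 : ℕ) * τ) - 2 * Real.pi * I * d) *
    exp (-(2 * Real.pi * I * (n + 1 : ℕ) * u)) := by
      simp only [← exp_add]
      congr 1; push_cast; ring
    linear_combination ((-1) ^ (n + 1) * theta1 (d + ∑ i, y i + u) τ * (∏ k, theta1 (u - y k) τ) *
      (∏ j, ∏ k ∈ Finset.Ioi j, theta1 (y j - y k) τ)) * h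

lemma DD_inV (n : ℕ) (d τ : ℂ) (hτ : 0 < τ.im) (y : Fin n → ℂ) :
    InV (n + 1) d τ (fun u => DD (n + 1) d τ (Fin.cons u y)) := by
  obtain ⟨c, hc⟩ : ∃ c : Fin (n + 1) → ℂ, ∀ u, DD (n + 1) d τ (Fin.cons u y) = ∑ k, c k * phi (n + 1) d τ k u := by
    refine ⟨fun k => (-1) ^ (k : ℕ) * Matrix.det (Matrix.of fun (i j : Fin n) => phi (n + 1) d τ (k.succAbove j) (y i)), fun u => ?_⟩
    rw [DD, Matrix.det_succ_row_zero]
    refine Finset.sum_congr rfl fun k _ => ?_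
    have : (Matrix.of fun j k : Fin (n + 1) => phi (n + 1) d τ k ((Fin.cons u y : Fin (n + 1) → ℂ) j)).submatrix Fin.succ k.succAbove
       = (Matrix.of fun (i j : Fin n) => phi (n + 1) d τ (k.succAbove j) (y i)) := by
      ext i j; simp
    rw [this]
    simp
    ring
  have hV := fun k : ℕ => phi_inV (n + 1) (by omega) d τ hτ k
  simp only [hc]
  refine ⟨?_, ?_, ?_⟩
  · exact Differentiable.fun_sum fun k _ => (hV k).1.const_mul _
  · intro u
    rw [Finset.mul_sum]
    exact Finset.sum_congr rfl fun k _ => by rw [(hV k).2.1]; ring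
  · intro u
    rw [Finset.mul_sum]
    exact Finset.sum_congr rfl fun k _ => by rw [(hV k).2.2]; ring

lemma FF_DD (n : ℕ) (d τ : ℂ) (hτ : 0 < τ.im) (s : ℂ)
    (hs : ∀ k < n + 1, phi (n + 1) d τ k s ≠ 0) (w : Fin (n + 1) → ℂ) (hw : ∀ j, w j = s + (j : ℕ) / (n + 1 : ℕ))
    (x : Fin (n + 1) → ℂ) :
    FF (n + 1) d τ x * DD (n + 1) d τ w - FF (n + 1) d τ w * DD (n + 1) d τ x = 0 := by
  refine alt_zero (fun x => FF (n + 1) d τ x * DD (n + 1) d τ w - FF (n + 1) d τ w * DD (n + 1) d τ x) w ?_ ?_ ?_ x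
  · intro x σ
    simp only [FF_perm, DD_perm]; ring
  · ring
  · intro y hy u
    refine inV_zero (n + 1) (by omega) d τ hτ s hs (fun u => FF (n + 1) d τ (Fin.cons u y) * DD (n + 1) d τ w - FF (n + 1) d τ w * DD (n + 1) d τ (Fin.cons u y)) ?_ ?_ u
    · obtain ⟨a1, a2, a3⟩ := FF_inV n d τ hτ y
      obtain ⟨b1, b2, b3⟩ := DD_inV n d τ hτ y
      refine ⟨(a1.mul_const _).sub (b1.const_mul _), fun u => ?_, fun u => ?_⟩
      · have := a2 u
        have := b2 u
        simp only at *
        simp only [a2, b2]; ring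
      · simp only [a3, b3]; ring
    · intro j hj
      have := hy ⟨j, hj⟩
      rw [hw] at this
      exact this

end detsec

section constsec
open Complex

lemma exp_half_pi : exp (Real.pi * I / 2) = I := by
  rw [show (Real.pi * I / 2 : ℂ) = Real.pi / 2 * I by ring, exp_pi_div_two_mul_I]

lemma sum_fin_cast (N : ℕ) : ∑ k : Fin N, ((k : ℕ) : ℂ) = N * (N - 1) / 2 := by
  rw [Fin.sum_univ_eq_sum_range (fun k => (k : ℂ))]
  induction N with
  | zero => simp
  | succ n ih => rw [Finset.sum_range_succ, ih]; push_cast; ring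

lemma sum_sym (N : ℕ) (a : Fin N → Fin N → ℂ) (ha : ∀ i j, a i j = a j i) :
    ∑ j, ∑ k ∈ Finset.Ioi j, a j k = (∑ j, ∑ k, a j k - ∑ j, a j j) / 2 := by
  have h := Finset.sum_sum_Ioi_add_eq_sum_sum_off_diag a
  have h1 : ∑ j, ∑ k ∈ Finset.Ioi j, (a j k + a k j) = 2 * ∑ j, ∑ k ∈ Finset.Ioi j, a j k := by
    simp only [Finset.mul_sum]
    exact Finset.sum_congr rfl fun j _ => Finset.sum_congr rfl fun k _ => by rw [ha k j]; ring
  have h1' : ∑ j, ∑ k ∈ Finset.Ioi j, (a k j + a j k) = 2 * ∑ j, ∑ k ∈ Finset.Ioi j, a j k := by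
    rw [← h1]
    exact Finset.sum_congr rfl fun j _ => Finset.sum_congr rfl fun k _ => by rw [add_comm]
  have h2 : ∑ j, ∑ k ∈ {j}ᶜ, a j k = ∑ j, ∑ k, a j k - ∑ j, a j j := by
    rw [← Finset.sum_sub_distrib]
    refine Finset.sum_congr rfl fun j _ => ?_
    rw [← Finset.sum_compl_add_sum {j}]; simp
  have h3 : ∑ j, ∑ k ∈ {j}ᶜ, a k j = ∑ j, ∑ k ∈ {j}ᶜ, a j k :=
    Finset.sum_congr rfl fun j _ => Finset.sum_congr rfl fun k _ => ha k j
  simp only [h1, h1', h2, h3] at h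
  rw [← h]; ring

lemma prod_pairs (N : ℕ) (g : Fin N → Fin N → ℂ) :
    (∏ j, ∏ k ∈ Finset.Ioi j, (g k j * g j k)) * ∏ j, g j j = ∏ j, ∏ k, g k j := by
  have h := Finset.prod_prod_Ioi_mul_eq_prod_prod_off_diag g
  rw [h, ← Finset.prod_mul_distrib]
  refine Finset.prod_congr rfl fun j _ => ?_
  rw [← Finset.prod_compl_mul_prod {j}]; simp

lemma prod_theta_dissect (N : ℕ) (hN : N ≠ 0) (v τ : ℂ) (hτ : 0 < τ.im) :
    ∏ k : Fin N, theta1 (v + (k : ℕ) * τ) (N * τ) =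
    exp (N * (Real.pi * I / 2) + Real.pi * I * N ^ 2 * τ / 4 - Real.pi * I * (N * v + N * (N - 1) / 2 * τ)) *
      q0 (N * τ) ^ N *
      (PP (exp (2 * Real.pi * I * τ)) (exp (2 * Real.pi * I * v)) *
        PP (exp (2 * Real.pi * I * τ)) (exp (2 * Real.pi * I * τ) / exp (2 * Real.pi * I * v))) := by
  have hNτ : 0 < ((N : ℂ) * τ).im := by
    have : (0:ℝ) < N := by positivity
    simp; positivity
  set Q := exp (2 * Real.pi * I * τ) with hQ
  set w := exp (2 * Real.pi * I * v) with hw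
  have hQN : exp (2 * Real.pi * I * (N * τ)) = Q ^ N := by
    rw [hQ, ← exp_nat_mul]; ring_nf
  have ht : ∀ k : Fin N, theta1 (v + (k : ℕ) * τ) (N * τ) =
      exp (Real.pi * I / 2 + Real.pi * I * (N * τ) / 4 - Real.pi * I * (v + (k : ℕ) * τ)) * q0 (N * τ) *
      (PP (Q ^ N) (Q ^ (k : ℕ) * w) * PP (Q ^ N) (Q ^ (N - 1 - (k : ℕ)) * (Q / w))) := by
    intro k
    have h1 : exp (2 * Real.pi * I * (v + (k : ℕ) * τ)) = Q ^ (k : ℕ) * w := by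
      rw [hQ, ← exp_nat_mul, ← exp_add]; ring_nf
    have h2 : Q ^ N / (Q ^ (k : ℕ) * w) = Q ^ (N - 1 - (k : ℕ)) * (Q / w) := by
      have : Q ^ N = Q ^ (k : ℕ) * Q ^ (N - 1 - (k : ℕ)) * Q := by
        rw [← pow_add, ← pow_succ]; congr 1; omega
      have hQ0 : Q ≠ 0 := exp_ne_zero _
      have hw0 : w ≠ 0 := exp_ne_zero _
      rw [this]; field_simp
    rw [theta1_prod _ hNτ, hQN, h1, h2, sub_eq_add_neg, exp_add, exp_add, exp_half_pi]
    ring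
  have hd1 := PP_dissect (norm_Q hτ) w N hN
  have hd2 := PP_dissect (norm_Q hτ) (Q / w) N hN
  rw [← Finset.prod_range_reflect] at hd2
  rw [← Fin.prod_univ_eq_prod_range (fun k => PP (Q ^ N) (Q ^ k * w))] at hd1
  rw [← Fin.prod_univ_eq_prod_range (fun k => PP (Q ^ N) (Q ^ (N - 1 - k) * (Q / w)))] at hd2
  simp only [ht, Finset.prod_mul_distrib, hd1, hd2, ← exp_sum, Finset.prod_const, Finset.card_univ, Fintype.card_fin]
  congr 3
  simp only [Finset.sum_sub_distrib, ← Finset.mul_sum, Finset.sum_add_distrib, ← Finset.sum_mul, sum_fin_cast, Finset.sum_const,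
    Finset.card_univ, Fintype.card_fin, nsmul_eq_mul]
  ring

lemma prod_theta_roots (N : ℕ) (hN : N ≠ 0) (τ : ℂ) (hτ : 0 < τ.im) :
    (∏ j : Fin N, ∏ k ∈ Finset.Ioi j, theta1 (((j : ℕ) - (k : ℕ)) / N) τ) * q0 τ ^ N =
    exp (N * (N - 1) / 2 * (Real.pi * I / 2 + Real.pi * I * τ / 4) - Real.pi * I * (N - 1) ^ 2 / 2) *
    q0 τ ^ (N * (N - 1) / 2) * q0 (N * τ) ^ N *
    ∏ j : Fin N, ∏ k ∈ Finset.Ioi j, (exp (2 * Real.pi * I / N) ^ (k : ℕ) - exp (2 * Real.pi * I / N) ^ (j : ℕ)) := by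
  have hN' : (N : ℂ) ≠ 0 := by exact_mod_cast hN
  have hζ := Complex.isPrimitiveRoot_exp N hN
  set ζ := exp (2 * Real.pi * I / N) with hζd
  have hζ0 : ζ ≠ 0 := exp_ne_zero _
  set Q := exp (2 * Real.pi * I * τ) with hQ
  have ht : ∀ j k : Fin N, theta1 (((j : ℕ) - (k : ℕ)) / N) τ =
      exp (Real.pi * I / 2 + Real.pi * I * τ / 4 - Real.pi * I / N * ((j : ℕ) + (k : ℕ))) * q0 τ *
      (ζ ^ (k : ℕ) - ζ ^ (j : ℕ)) *
      (PP Q (ζ ^ (k : ℕ) * (Q / ζ ^ (j : ℕ))) * PP Q (ζ ^ (j : ℕ) * (Q / ζ ^ (k : ℕ)))) := by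
    intro j k
    have h1 : exp (2 * Real.pi * I * (((j : ℕ) - (k : ℕ)) / N)) = ζ ^ (j : ℕ) / ζ ^ (k : ℕ) := by
      rw [hζd, ← exp_nat_mul, ← exp_nat_mul, ← exp_sub]; congr 1; ring
    have h2 : Q / (ζ ^ (j : ℕ) / ζ ^ (k : ℕ)) = ζ ^ (k : ℕ) * (Q / ζ ^ (j : ℕ)) := by
      field_simp
    have h3 : Q * (ζ ^ (j : ℕ) / ζ ^ (k : ℕ)) = ζ ^ (j : ℕ) * (Q / ζ ^ (k : ℕ)) := by ring
    have h4 : exp (-(Real.pi * I * (((j : ℕ) - (k : ℕ)) / N))) * (1 - ζ ^ (j : ℕ) / ζ ^ (k : ℕ)) =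
       exp (-(Real.pi * I / N * ((j : ℕ) + (k : ℕ)))) * (ζ ^ (k : ℕ) - ζ ^ (j : ℕ)) := by
      have : exp (-(Real.pi * I * (((j : ℕ) - (k : ℕ)) / N))) = exp (-(Real.pi * I / N * ((j : ℕ) + (k : ℕ)))) * ζ ^ (k : ℕ) := by
        rw [hζd, ← exp_nat_mul, ← exp_add]; congr 1; ring
      rw [this]; field_simp
    have h5 : exp (Real.pi * I / 2 + Real.pi * I * τ / 4 - Real.pi * I / N * ((j : ℕ) + (k : ℕ))) =
        I * exp (Real.pi * I * τ / 4) * exp (-(Real.pi * I / N * ((j : ℕ) + (k : ℕ)))) := by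
      rw [sub_eq_add_neg, exp_add, exp_add, exp_half_pi]
    rw [theta1_prod _ hτ, ← hQ, h1, h2, PP_succ (norm_Q hτ) (ζ ^ (j : ℕ) / ζ ^ (k : ℕ)), ← hQ, h3, h5]
    linear_combination (I * exp (Real.pi * I * τ / 4) * q0 τ *
      (PP Q (ζ ^ (k : ℕ) * (Q / ζ ^ (j : ℕ))) * PP Q (ζ ^ (j : ℕ) * (Q / ζ ^ (k : ℕ))))) * h4
  have hp := prod_pairs N (fun j k => PP Q (ζ ^ (j : ℕ) * (Q / ζ ^ (k : ℕ))))
  have hd : ∀ j : Fin N, PP Q (ζ ^ (j : ℕ) * (Q / ζ ^ (j : ℕ))) = q0 τ := fun j => by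
    rw [q0_eq, ← hQ]; congr 1; field_simp
  have hr : ∀ k : Fin N, ∏ j : Fin N, PP Q (ζ ^ (j : ℕ) * (Q / ζ ^ (k : ℕ))) = q0 (N * τ) := fun k => by
    rw [Fin.prod_univ_eq_prod_range (fun j => PP Q (ζ ^ j * (Q / ζ ^ (k : ℕ)))), PP_roots (norm_Q hτ) _ ζ N hN hζ, q0_eq]
    have hQN : exp (2 * Real.pi * I * (N * τ)) = Q ^ N := by
      rw [hQ, ← exp_nat_mul]; ring_nf
    rw [hQN, div_pow, ← pow_mul, mul_comm (k : ℕ), pow_mul, hζ.pow_eq_one, one_pow, div_one]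
  simp only [hd, hr, Finset.prod_const, Finset.card_univ, Fintype.card_fin] at hp
  have hc : ∏ j : Fin N, ∏ k ∈ Finset.Ioi j, q0 τ = q0 τ ^ (N * (N - 1) / 2) := by
    simp only [Finset.prod_const, Fin.card_Ioi, Finset.prod_pow_eq_pow_sum]
    congr 1
    rw [Fin.sum_univ_eq_sum_range (fun k => N - 1 - k), Finset.sum_range_reflect (fun k => k), Finset.sum_range_id]
  simp only [ht, Finset.prod_mul_distrib, hc, ← exp_sum] at hp ⊢
  have hs : ∑ j : Fin N, ∑ k ∈ Finset.Ioi j, (Real.pi * I / 2 + Real.pi * I * τ / 4 - Real.pi * I / N * (((j : ℕ) : ℂ) + (k : ℕ))) =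
      N * (N - 1) / 2 * (Real.pi * I / 2 + Real.pi * I * τ / 4) - Real.pi * I * (N - 1) ^ 2 / 2 := by
    rw [sum_sym _ _ (fun i j => by ring)]
    simp only [Finset.sum_sub_distrib, ← Finset.mul_sum, Finset.sum_add_distrib, ← Finset.sum_mul, sum_fin_cast, Finset.sum_const,
      Finset.card_univ, Fintype.card_fin, nsmul_eq_mul]
    field_simp
    ring
  rw [hs]
  linear_combination (exp (N * (N - 1) / 2 * (Real.pi * I / 2 + Real.pi * I * τ / 4) - Real.pi * I * (N - 1) ^ 2 / 2) *
    q0 τ ^ (N * (N - 1) / 2) *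
    ∏ j : Fin N, ∏ k ∈ Finset.Ioi j, (ζ ^ (k : ℕ) - ζ ^ (j : ℕ))) * hp

lemma phi_add_nat (N : ℕ) (hN : N ≠ 0) (d τ : ℂ) (k j : ℕ) (u : ℂ) :
    phi N d τ k (u + j / N) = (-1) ^ j * (exp (2 * Real.pi * I / N) ^ j) ^ k * phi N d τ k u := by
  induction j with
  | zero => simp
  | succ j ih =>
    rw [show u + (j + 1 : ℕ) / (N : ℂ) = u + j / N + 1 / N by push_cast; ring, phi_add_inv N hN, ih]
    ring

lemma DD_w (N : ℕ) (hN : N ≠ 0) (d τ s : ℂ) (w : Fin N → ℂ) (hw : ∀ j, w j = s + (j : ℕ) / N) :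
    DD N d τ w = (∏ k : Fin N, phi N d τ k s) * (exp (Real.pi * I * (N * (N - 1) / 2)) *
      ∏ j : Fin N, ∏ k ∈ Finset.Ioi j, (exp (2 * Real.pi * I / N) ^ (k : ℕ) - exp (2 * Real.pi * I / N) ^ (j : ℕ))) := by
  rw [DD, ← Matrix.det_vandermonde (fun j : Fin N => exp (2 * Real.pi * I / N) ^ (j : ℕ))]
  have h : exp (Real.pi * I * (N * (N - 1) / 2)) = ∏ j : Fin N, (-1) ^ (j : ℕ) := by
    simp only [← exp_pi_nat, ← exp_sum, ← Finset.mul_sum, sum_fin_cast]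
  rw [h, ← Matrix.det_mul_column, ← Matrix.det_mul_row]
  congr 1
  ext j k
  simp [hw, phi_add_nat N hN, Matrix.vandermonde]
  ring

end constsec

section finalsec
open Complex

lemma PP_neg_ne {Q : ℂ} (hQ : ‖Q‖ < 1) : PP Q (-1) ≠ 0 := by
  apply PP_ne_zero hQ
  intro n h
  rcases Nat.eq_zero_or_pos n with rfl | hn
  · norm_num at h
  · have h1 := congrArg norm h
    simp only [norm_mul, norm_pow, norm_neg, norm_one, mul_one] at h1
    exact absurd h1 (pow_lt_one₀ (norm_nonneg _) hQ hn.ne').ne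

lemma PP_small_ne {Q z : ℂ} (hQ : ‖Q‖ < 1) (hz : ‖z‖ < 1) : PP Q z ≠ 0 := by
  apply PP_ne_zero hQ
  intro n h
  have h1 := congrArg norm h
  simp only [norm_mul, norm_pow, norm_one] at h1
  have h2 : ‖Q‖ ^ n ≤ 1 := pow_le_one₀ (norm_nonneg _) hQ.le
  nlinarith [norm_nonneg z, norm_nonneg Q]

lemma q0_ne {τ : ℂ} (hτ : 0 < τ.im) : q0 τ ≠ 0 := by
  rw [q0_eq]
  exact PP_small_ne (norm_Q hτ) (norm_Q hτ)

lemma exp_nn (N : ℕ) : exp (Real.pi * I * (N * (N - 1))) = 1 := by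
  rcases N with _ | n
  · simp
  · have h := exp_pi_nat ((n + 1) * n)
    rw [show (Real.pi * I * (((n + 1 : ℕ) : ℂ) * ((n + 1 : ℕ) - 1)) : ℂ) = Real.pi * I * (((n + 1) * n : ℕ) : ℂ) by push_cast; ring, h]
    exact Even.neg_one_pow (by rw [mul_comm]; exact Nat.even_mul_succ_self n)

lemma nat_expo (n : ℕ) : (n + 1) * (n + 1 - 1) / 2 + 1 = (n + 1) + (n + 1 - 1) * (n + 1 - 2) / 2 := by
  rcases n with _ | m
  · simp
  · simp only [Nat.add_sub_cancel]
    rw [show (m + 1 + 1) * (m + 1) = (m + 1) * (m + 1 + 1 - 2) + (m + 1) * 2 by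
      rw [show m + 1 + 1 - 2 = m by omega]; ring]
    rw [Nat.add_mul_div_right _ _ (by norm_num)]
    omega

lemma FF_eq (n : ℕ) (d τ : ℂ) (hτ : 0 < τ.im) (x : Fin (n + 1) → ℂ) :
    FF (n + 1) d τ x = (q0 τ ^ ((n + 1 - 1) * (n + 1 - 2) / 2) *
      exp ((((n + 1 : ℕ) : ℂ) - 1) * ((3 * ((n + 1 : ℕ) : ℂ) - 2) / 8 * τ + d + (3 * ((n + 1 : ℕ) : ℂ) - 2) / 4) * Real.pi * I)) *
      DD (n + 1) d τ x := by
  revert x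
  have hex := nat_expo n
  have hFD := FF_DD n d τ hτ
  have hN : n + 1 ≠ 0 := by omega
  have hV : ∏ j : Fin (n + 1), ∏ k ∈ Finset.Ioi j, (exp (2 * Real.pi * I / (n + 1 : ℕ)) ^ (k : ℕ) - exp (2 * Real.pi * I / (n + 1 : ℕ)) ^ (j : ℕ)) ≠ 0 := by
    have hζ := Complex.isPrimitiveRoot_exp (n + 1) hN
    refine Finset.prod_ne_zero_iff.2 fun j _ => Finset.prod_ne_zero_iff.2 fun k hk => ?_
    rw [Finset.mem_Ioi] at hk
    intro h
    have := hζ.pow_inj k.2 j.2 (sub_eq_zero.1 h)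
    exact hk.ne' (Fin.ext this)
  have hNC : ((n + 1 : ℕ) : ℂ) ≠ 0 := by exact_mod_cast hN
  have hdis := prod_theta_dissect (n + 1) hN (1 / 2) τ hτ
  have hroot := prod_theta_roots (n + 1) hN τ hτ
  have hth := theta1_prod (1 / 2) hτ
  have hw1 : exp (2 * Real.pi * I * (1 / 2)) = -1 := by
    rw [show (2 * Real.pi * I * (1 / 2) : ℂ) = Real.pi * I by ring, exp_pi_mul_I]
  rw [hw1] at hdis hth
  set N := n + 1 with hNd
  intro x
  have hNτ : 0 < ((N : ℂ) * τ).im := by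
    have : (0:ℝ) < N := by positivity
    simp; positivity
  have hq := q0_ne hτ
  have hqN := q0_ne hNτ
  have hP : PP (exp (2 * Real.pi * I * τ)) (-1) * PP (exp (2 * Real.pi * I * τ)) (exp (2 * Real.pi * I * τ) / -1) ≠ 0 :=
    mul_ne_zero (PP_neg_ne (norm_Q hτ)) (PP_small_ne (norm_Q hτ) (by simpa using norm_Q hτ))
  set P1 := PP (exp (2 * Real.pi * I * τ)) (-1)
  set P2 := PP (exp (2 * Real.pi * I * τ)) (exp (2 * Real.pi * I * τ) / -1)
  set V := ∏ j : Fin N, ∏ k ∈ Finset.Ioi j, (exp (2 * Real.pi * I / N) ^ (k : ℕ) - exp (2 * Real.pi * I / N) ^ (j : ℕ))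
  obtain ⟨s, hs⟩ : ∃ s : ℂ, s = (1 / 2 - (N - 1) / 2 - d) / N := ⟨_, rfl⟩
  have hs' : (N : ℂ) * s = 1 / 2 - (N - 1) / 2 - d := by rw [hs]; field_simp
  obtain ⟨w, hw⟩ : ∃ w : Fin N → ℂ, ∀ j, w j = s + (j : ℕ) / N := ⟨_, fun j => rfl⟩
  have hphi : ∀ k : ℕ, phi N d τ k s = exp (2 * Real.pi * I * k * s) * theta1 (1 / 2 + k * τ) (N * τ) := by
    intro k
    rw [phi]
    congr 2
    linear_combination hs'
  have hphiP : ∏ k : Fin N, phi N d τ k s = exp (Real.pi * I * (N - 1) * (N * s)) * ∏ k : Fin N, theta1 (1 / 2 + (k : ℕ) * τ) (N * τ) := by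
    simp only [hphi, Finset.prod_mul_distrib, ← exp_sum]
    congr 2
    rw [← Finset.sum_mul, ← Finset.mul_sum, sum_fin_cast]
    ring
  rw [hs', hdis] at hphiP
  have hne : ∏ k : Fin N, phi N d τ k s ≠ 0 := by
    rw [hphiP]
    exact mul_ne_zero (exp_ne_zero _) (mul_ne_zero (mul_ne_zero (exp_ne_zero _) (pow_ne_zero _ hqN)) hP)
  have hDw := DD_w N hN d τ s w hw
  have hDne : DD N d τ w ≠ 0 := by
    rw [hDw]
    exact mul_ne_zero hne (mul_ne_zero (exp_ne_zero _) hV)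
  have key := hFD s (fun k hk => by
    have := Finset.prod_ne_zero_iff.1 hne ⟨k, hk⟩ (Finset.mem_univ _)
    exact this) w hw x
  have hFw : FF N d τ w = theta1 (1 / 2) τ * ∏ j : Fin N, ∏ k ∈ Finset.Ioi j, theta1 (((j : ℕ) - (k : ℕ)) / N) τ := by
    rw [FF]
    congr 1
    · congr 1
      simp only [hw, Finset.sum_add_distrib, ← Finset.sum_div, sum_fin_cast, Finset.sum_const, Finset.card_univ, Fintype.card_fin, nsmul_eq_mul, hs']
      field_simp
      ring
    · refine Finset.prod_congr rfl fun j _ => Finset.prod_congr rfl fun k _ => ?_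
      rw [hw, hw]; congr 1; ring
  set C := q0 τ ^ ((N - 1) * (N - 2) / 2) * exp (((N : ℂ) - 1) * ((3 * (N : ℂ) - 2) / 8 * τ + d + (3 * (N : ℂ) - 2) / 4) * Real.pi * I) with hC
  have hFwC : FF N d τ w = C * DD N d τ w := by
    apply mul_right_cancel₀ (pow_ne_zero N hq)
    rw [hFw, mul_assoc, hroot, hDw, hphiP, hth, hC]
    have hpow : q0 τ ^ (N * (N - 1) / 2) * q0 τ = q0 τ ^ N * q0 τ ^ ((N - 1) * (N - 2) / 2) := by
      rw [← pow_succ, ← pow_add, hex]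
    have hexp : I * exp (Real.pi * I * τ / 4) * exp (-(Real.pi * I * (1 / 2))) *
        exp (N * (N - 1) / 2 * (Real.pi * I / 2 + Real.pi * I * τ / 4) - Real.pi * I * (N - 1) ^ 2 / 2) =
        exp (((N : ℂ) - 1) * ((3 * (N : ℂ) - 2) / 8 * τ + d + (3 * (N : ℂ) - 2) / 4) * Real.pi * I) *
        exp (Real.pi * I * (N - 1) * (1 / 2 - (N - 1) / 2 - d)) *
        exp (N * (Real.pi * I / 2) + Real.pi * I * N ^ 2 * τ / 4 - Real.pi * I * (N * (1 / 2) + N * (N - 1) / 2 * τ)) *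
        exp (Real.pi * I * (N * (N - 1) / 2)) := by
      have hI : I * exp (Real.pi * I * τ / 4) = exp (Real.pi * I / 2 + Real.pi * I * τ / 4) := by
        rw [exp_add, exp_half_pi]
      rw [hI]
      refine Eq.trans (mul_one _).symm ?_
      refine Eq.trans (congrArg _ (exp_nn N).symm) ?_
      simp only [← exp_add]
      congr 1
      ring
    linear_combination (q0 τ * P1 * P2 * q0 τ ^ (N * (N - 1) / 2) * q0 (N * τ) ^ N * V) * hexp +
      (exp (((N : ℂ) - 1) * ((3 * (N : ℂ) - 2) / 8 * τ + d + (3 * (N : ℂ) - 2) / 4) * Real.pi * I) *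
        exp (Real.pi * I * (N - 1) * (1 / 2 - (N - 1) / 2 - d)) *
        exp (N * (Real.pi * I / 2) + Real.pi * I * N ^ 2 * τ / 4 - Real.pi * I * (N * (1 / 2) + N * (N - 1) / 2 * τ)) *
        exp (Real.pi * I * (N * (N - 1) / 2)) * P1 * P2 * q0 (N * τ) ^ N * V) * hpow
  apply mul_right_cancel₀ hDne
  linear_combination key + DD N d τ x * hFwC

end finalsec

theorem stmt_4 (N : ℕ) (hN : 2 ≤ N) (r : ℝ) (hr : 0 < r) (δ : ℝ)
    (hδ : ∃ m : ℤ, δ = Real.pi * r * m)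
    (τ : ℂ) (hτ : 0 < τ.im) (x : Fin N → ℂ) :
    theta1 (((δ : ℂ) + ∑ i, x i) / (2 * Real.pi * r)) τ *
        (∏ j : Fin N, ∏ k : Fin N,
          if j < k then theta1 ((x j - x k) / (2 * Real.pi * r)) τ else 1) =
      (q0 τ ^ ((N - 1) * (N - 2) / 2) *
          Complex.exp (((N : ℂ) - 1) *
            ((3 * (N : ℂ) - 2) / 8 * τ + (δ : ℂ) / (2 * Real.pi * r) + (3 * (N : ℂ) - 2) / 4) *
            Real.pi * Complex.I)) *
        Matrix.det (Matrix.of fun j k : Fin N =>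
          Complex.exp (Complex.I * (k : ℕ) * x j / (r : ℂ)) *
            theta1 (((N : ℂ) - 1) / 2 + ((k : ℕ) : ℂ) * τ +
              ((δ : ℂ) + (N : ℂ) * x j) / (2 * Real.pi * r)) ((N : ℂ) * τ)) := by
  obtain ⟨n, rfl⟩ : ∃ n, N = n + 1 := ⟨N - 1, by omega⟩
  have hr' : (r : ℂ) ≠ 0 := by exact_mod_cast hr.ne'
  have hpi : (Real.pi : ℂ) ≠ 0 := by exact_mod_cast Real.pi_ne_zero
  have h := FF_eq n ((δ : ℂ) / (2 * Real.pi * r)) τ hτ (fun j => x j / (2 * Real.pi * r))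
  convert h using 1
  · rw [FF]
    congr 1
    · congr 1
      rw [add_div, Finset.sum_div]
    · refine Finset.prod_congr rfl fun j _ => ?_
      rw [← Finset.prod_filter]
      refine Finset.prod_congr ?_ fun k _ => ?_
      · ext k; simp
      · rw [sub_div]
  · congr 1
    rw [DD]
    congr 1
    ext j k
    simp only [Matrix.of_apply, phi]
    congr 2
    · field_simp
    · ring
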